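/- arXiv:math/0308138 — 2 statements merged into one kernel-verified Lean document; each statement's English description precedes it below -/
import Mathlib

section
/- Let V be a finite-dimensional module over the quaternion algebra ℍ = Quaternion ℝ whose real dimension is 4l, equipped with a real inner product ⟨·,·⟩ that is invariant under the quaternionic structure, i.e. ⟨i•v, i•w⟩ = ⟨v, w⟩, ⟨j•v, j•w⟩ = ⟨v, w⟩ and ⟨k•v, k•w⟩ = ⟨v, w⟩ for all v, w ∈ V (where i, j, k denote scalar multiplication by the quaternion units). Let Q be a symmetric real-bilinear form on V such that for every nonzero vector X ∈ V one has Q(X,X) + Q(i•X, i•X) + Q(j•X, j•X) + Q(k•X, k•X) < 0. Then the index of Q is at least l; that is, there exists a real-linear subspace U ⊆ V with dim_ℝ U ≥ l on which Q is negative definite (Q(v,v) < 0 for every nonzero v ∈ U). -/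
open scoped Quaternion
open Module

/-- The quaternion unit `i` in `ℍ = Quaternion ℝ`. -/
noncomputable def qI : ℍ[ℝ] := ⟨0, 1, 0, 0⟩

/-- The quaternion unit `j` in `ℍ = Quaternion ℝ`. -/
noncomputable def qJ : ℍ[ℝ] := ⟨0, 0, 1, 0⟩

/-- The quaternion unit `k` in `ℍ = Quaternion ℝ`. -/
noncomputable def qK : ℍ[ℝ] := ⟨0, 0, 0, 1⟩

/-- A negative definite subspace can be enlarged by a negative vector orthogonal to it. -/
theorem exists_negDef_finrank_succ {V : Type*} [AddCommGroup V] [Module ℝ V]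
    [FiniteDimensional ℝ V] (Q : V →ₗ[ℝ] V →ₗ[ℝ] ℝ) (Q_symm : ∀ v w : V, Q v w = Q w v)
    {U : Submodule ℝ V} (hU : ∀ u ∈ U, u ≠ 0 → Q u u < 0)
    {v : V} (hv : ∀ u ∈ U, Q v u = 0) (hneg : Q v v < 0) :
    ∃ W : Submodule ℝ V, finrank ℝ U + 1 ≤ finrank ℝ W ∧ ∀ w ∈ W, w ≠ 0 → Q w w < 0 := by
  refine ⟨U ⊔ Submodule.span ℝ {v}, ?_, ?_⟩
  · refine Submodule.finrank_lt_finrank_of_lt (lt_of_le_of_ne le_sup_left fun h => ?_)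
    have hvU : v ∈ U := h ▸ Submodule.mem_sup_right (Submodule.mem_span_singleton_self v)
    exact hneg.ne (hv v hvU)
  · intro w hw hw0
    obtain ⟨u, hu, y, hy, rfl⟩ := Submodule.mem_sup.mp hw
    obtain ⟨c, rfl⟩ := Submodule.mem_span_singleton.mp hy
    have expand : Q (u + c • v) (u + c • v) = Q u u + c ^ 2 * Q v v := by
      simp only [map_add, map_smul, LinearMap.add_apply, LinearMap.smul_apply, smul_eq_mul,
        Q_symm u v, hv u hu]
      ring
    rw [expand]
    rcases eq_or_ne c 0 with rfl | hc
    · simpa using hU u hu (by simpa using hw0)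
    · have hcv : c ^ 2 * Q v v < 0 := mul_neg_of_pos_of_neg (by positivity) hneg
      rcases eq_or_ne u 0 with rfl | hu0
      · simpa using hcv
      · exact add_neg (hU u hu hu0) hcv

/-- If `4 * dim U < dim V`, then for any four endomorphisms of `V` some nonzero vector has all
four images orthogonal to `U`. -/
theorem exists_ne_zero_forall_orthogonal {V : Type*} [AddCommGroup V] [Module ℝ V]
    [FiniteDimensional ℝ V] (Q : V →ₗ[ℝ] V →ₗ[ℝ] ℝ) (f : Fin 4 → Module.End ℝ V)
    (U : Submodule ℝ V) (hU : 4 * finrank ℝ U < finrank ℝ V) :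
    ∃ X : V, X ≠ 0 ∧ ∀ a, ∀ u ∈ U, Q (f a X) u = 0 := by
  let F : V →ₗ[ℝ] (Fin 4 → Module.Dual ℝ U) :=
    LinearMap.pi fun a => U.subtype.dualMap ∘ₗ Q ∘ₗ f a
  have hF : LinearMap.ker F ≠ ⊥ := by
    apply LinearMap.ker_ne_bot_of_finrank_lt
    simpa [Module.finrank_pi_fintype, Subspace.dual_finrank_eq] using hU
  obtain ⟨X, hX, hX0⟩ := Submodule.exists_mem_ne_zero_of_ne_bot hF
  refine ⟨X, hX0, fun a u hu => ?_⟩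
  exact LinearMap.congr_fun (congrFun (LinearMap.mem_ker.mp hX) a) ⟨u, hu⟩

/-- Lemma 4.1: if `V` is a quaternionic vector space of real dimension `4l` with an
invariant real inner product, and `Q` is a symmetric real-bilinear form on `V` such that
`Q(X,X) + Q(iX,iX) + Q(jX,jX) + Q(kX,kX) < 0` for every nonzero `X`, then the index of
`Q` is at least `l`: there is a real subspace of dimension at least `l` on which `Q` is
negative definite. -/
theorem index_ge_of_quaternionic_negativity
    (V : Type*) [AddCommGroup V] [Module ℍ[ℝ] V] [Module ℝ V]
    [IsScalarTower ℝ ℍ[ℝ] V] [FiniteDimensional ℝ V] (l : ℕ)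
    (hdim : finrank ℝ V = 4 * l)
    (inner : V →ₗ[ℝ] V →ₗ[ℝ] ℝ)
    (inner_symm : ∀ v w : V, inner v w = inner w v)
    (inner_pos : ∀ v : V, v ≠ 0 → 0 < inner v v)
    (inner_inv_i : ∀ v w : V, inner (qI • v) (qI • w) = inner v w)
    (inner_inv_j : ∀ v w : V, inner (qJ • v) (qJ • w) = inner v w)
    (inner_inv_k : ∀ v w : V, inner (qK • v) (qK • w) = inner v w)
    (Q : V →ₗ[ℝ] V →ₗ[ℝ] ℝ)
    (Q_symm : ∀ v w : V, Q v w = Q w v)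
    (hQ : ∀ X : V, X ≠ 0 →
      Q X X + Q (qI • X) (qI • X) + Q (qJ • X) (qJ • X) + Q (qK • X) (qK • X) < 0) :
    ∃ U : Submodule ℝ V, l ≤ finrank ℝ U ∧ ∀ v ∈ U, v ≠ 0 → Q v v < 0 := by
  suffices h : ∀ n ≤ l, ∃ U : Submodule ℝ V,
      n ≤ finrank ℝ U ∧ ∀ v ∈ U, v ≠ 0 → Q v v < 0 from h l le_rfl
  intro n
  induction n with
  | zero => exact fun _ => ⟨⊥, Nat.zero_le _, fun v hv hv0 => absurd hv hv0⟩
  | succ n ih =>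
    intro hn
    obtain ⟨U, hnU, hU⟩ := ih (by omega)
    by_cases hlU : n + 1 ≤ finrank ℝ U
    · exact ⟨U, hlU, hU⟩
    have : SMulCommClass ℝ ℍ[ℝ] V := IsScalarTower.to_smulCommClass
    let q : Fin 4 → ℍ[ℝ] := ![1, qI, qJ, qK]
    obtain ⟨X, hX0, hX⟩ := exists_ne_zero_forall_orthogonal Q
      (fun a => Algebra.lsmul ℝ ℝ V (q a)) U (by omega)
    obtain ⟨a, ha⟩ : ∃ a, Q (q a • X) (q a • X) < 0 := by
      by_contra! hnonneg
      have h0 : 0 ≤ Q X X := by simpa [q] using hnonneg 0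
      have h1 : 0 ≤ Q (qI • X) (qI • X) := hnonneg 1
      have h2 : 0 ≤ Q (qJ • X) (qJ • X) := hnonneg 2
      have h3 : 0 ≤ Q (qK • X) (qK • X) := hnonneg 3
      linarith [hQ X hX0]
    obtain ⟨W, hW, hWneg⟩ := exists_negDef_finrank_succ Q Q_symm hU (hX a) ha
    exact ⟨W, by omega, hWneg⟩
end

section
/- Let N be a nonempty connected Hausdorff topological space, M a topological space, and f : N → M a locally injective map (every point of N has a neighborhood on which f is injective). If f is not injective, then the coincidence set C = {(x, y) ∈ N × N : f(x) = f(y)} is not a connected (equivalently, not a preconnected) subset of N × N. Equivalently, if the coincidence set of a locally injective map on a connected Hausdorff space is connected, then the map is injective. -/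
/-- If `N` is a nonempty connected Hausdorff space and `f : N → M` is locally injective
with preconnected coincidence set `C = {(x, y) | f x = f y}`, then `f` is injective.
(Equivalently: a locally injective non-injective map on a connected Hausdorff space has
disconnected coincidence set.) -/
theorem injective_of_isPreconnected_coincidence_set
    {N M : Type*} [TopologicalSpace N] [TopologicalSpace M]
    [T2Space N] [ConnectedSpace N] (f : N → M)
    (hf : ∀ x : N, ∃ U ∈ nhds x, Set.InjOn f U)
    (hconn : IsPreconnected {p : N × N | f p.1 = f p.2}) :
    Function.Injective f := by
  intro a b hab
  by_contra hne
  have hopen : IsOpen {p : N × N | ∃ U, IsOpen U ∧ Set.InjOn f U ∧ p ∈ U ×ˢ U} := by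
    refine isOpen_iff_forall_mem_open.2 fun p ⟨U, hU, hinj, hp⟩ => ?_
    exact ⟨U ×ˢ U, fun q hq => ⟨U, hU, hinj, hq⟩, hU.prod hU, hp⟩
  have hdiag (x : N) : ∃ U, IsOpen U ∧ Set.InjOn f U ∧ (x, x) ∈ U ×ˢ U := by
    obtain ⟨U, hU, hinj⟩ := hf x
    have hx := mem_interior_iff_mem_nhds.2 hU
    exact ⟨interior U, isOpen_interior, hinj.mono interior_subset, hx, hx⟩
  obtain ⟨⟨x, y⟩, hxy, ⟨U, -, hinj, hx, hy⟩, hne'⟩ :=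
    hconn _ (Set.diagonal N)ᶜ hopen isClosed_diagonal.isOpen_compl
      (fun ⟨x, y⟩ _ => by
        by_cases h : x = y
        · subst h
          exact Or.inl (hdiag x)
        · exact Or.inr h)
      ⟨(a, a), rfl, hdiag a⟩ ⟨(a, b), hab, hne⟩
  exact hne' (hinj hx hy hxy)
end
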